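/- For a triangulation T of P and a permutation σ of [n+1], the following are equivalent: (a) the set of arcs of the spine of T is exactly {(σ⁻¹(k), σ⁻¹(k+1)) : k ∈ [n]}, i.e., the spine is a directed Hamiltonian path visiting σ⁻¹(1), σ⁻¹(2), …, σ⁻¹(n+1) in this order; (b) for all i, j ∈ [n+1] with σ(i) < σ(j) there is a directed path from i to j in the spine of T; (c) x_j(T) = σ(j) for all j ∈ [n+1]. -/

import Mathlib

attribute [local instance] Classical.propDecidable

noncomputable section

namespace Spines

/-- Position of vertex `v ∈ {0,…,n+2}` in the counterclockwise boundary cyclic order: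
`0`, then the elements of `D` in increasing order, then `n+2`, then the elements of `U`
in decreasing order. -/
def pos (n : ℕ) (D U : Finset ℕ) (v : ℕ) : ℕ :=
  if v = 0 then 0
  else if v = n + 2 then D.card + 1
  else if v ∈ D then 1 + (D.filter (fun d => d < v)).card
  else D.card + 2 + (U.filter (fun u => v < u)).card

/-- Cyclic distance from `a` to `v` in counterclockwise direction. -/
def relpos (n : ℕ) (D U : Finset ℕ) (a v : ℕ) : ℕ :=
  (pos n D U v + (n + 3) - pos n D U a) % (n + 3)

/-- `v` lies strictly inside the counterclockwise boundary arc from `a` to `b`. -/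
def StrictBetween (n : ℕ) (D U : Finset ℕ) (a b v : ℕ) : Prop :=
  v ≤ n + 2 ∧ 0 < relpos n D U a v ∧ relpos n D U a v < relpos n D U a b

/-- A diagonal, encoded as an ordered pair `(a,b)` with `a < b ≤ n+2`. -/
def IsDiag (n : ℕ) (δ : ℕ × ℕ) : Prop := δ.1 < δ.2 ∧ δ.2 ≤ n + 2

/-- A boundary edge: the endpoints are adjacent in the cyclic order. -/
def IsBoundaryEdge (n : ℕ) (D U : Finset ℕ) (δ : ℕ × ℕ) : Prop :=
  IsDiag n δ ∧ (relpos n D U δ.1 δ.2 = 1 ∨ relpos n D U δ.2 δ.1 = 1)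

/-- An internal diagonal. -/
def IsInternalDiag (n : ℕ) (D U : Finset ℕ) (δ : ℕ × ℕ) : Prop :=
  IsDiag n δ ∧ ¬ IsBoundaryEdge n D U δ

/-- Two diagonals cross: the four endpoints are pairwise distinct and exactly one
endpoint of the second lies strictly inside each of the two arcs determined by the first. -/
def Cross (n : ℕ) (D U : Finset ℕ) (δ δ' : ℕ × ℕ) : Prop :=
  δ.1 ≠ δ.2 ∧ δ'.1 ≠ δ'.2 ∧ δ.1 ≠ δ'.1 ∧ δ.1 ≠ δ'.2 ∧ δ.2 ≠ δ'.1 ∧ δ.2 ≠ δ'.2 ∧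
  ((StrictBetween n D U δ.1 δ.2 δ'.1 ∧ StrictBetween n D U δ.2 δ.1 δ'.2) ∨
   (StrictBetween n D U δ.1 δ.2 δ'.2 ∧ StrictBetween n D U δ.2 δ.1 δ'.1))

/-- A triangulation: a maximal set of pairwise non-crossing internal diagonals. -/
def IsTriangulation (n : ℕ) (D U : Finset ℕ) (T : Finset (ℕ × ℕ)) : Prop :=
  (∀ δ ∈ T, IsInternalDiag n D U δ) ∧
  (∀ δ ∈ T, ∀ δ' ∈ T, ¬ Cross n D U δ δ') ∧
  (∀ δ, IsInternalDiag n D U δ → δ ∉ T → ∃ δ' ∈ T, Cross n D U δ δ')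

/-- `a` and `b` (with `a < b`) are joined by a diagonal of `T` or a boundary edge. -/
def EdgeOf (n : ℕ) (D U : Finset ℕ) (T : Finset (ℕ × ℕ)) (a b : ℕ) : Prop :=
  (a, b) ∈ T ∨ IsBoundaryEdge n D U (a, b)

/-- `{i,j,k}` with `i<j<k` is a triangle of the triangulation `T`. -/
def IsTriangleOf (n : ℕ) (D U : Finset ℕ) (T : Finset (ℕ × ℕ)) (i j k : ℕ) : Prop :=
  i < j ∧ j < k ∧ k ≤ n + 2 ∧
    EdgeOf n D U T i j ∧ EdgeOf n D U T j k ∧ EdgeOf n D U T i k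

/-- `Bel δ`: labels in `[n+1]` strictly inside the ccw arc from `δ.1` to `δ.2`,
together with the endpoints of `δ` lying in `U`. -/
def Bel (n : ℕ) (D U : Finset ℕ) (δ : ℕ × ℕ) : Finset ℕ :=
  (Finset.Icc 1 (n + 1)).filter
    (fun j => StrictBetween n D U δ.1 δ.2 j ∨ (j ∈ U ∧ (j = δ.1 ∨ j = δ.2)))

def bel (n : ℕ) (D U : Finset ℕ) (δ : ℕ × ℕ) : ℕ := (Bel n D U δ).card

def Abo (n : ℕ) (D U : Finset ℕ) (δ : ℕ × ℕ) : Finset ℕ :=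
  Finset.Icc 1 (n + 1) \ Bel n D U δ

/-- The coordinates of the point `x(T)` associated to a triangulation `T`. -/
def xcoord (n : ℕ) (D U : Finset ℕ) (T : Finset (ℕ × ℕ)) (j : ℕ) : ℝ :=
  if h : ∃ p : ℕ × ℕ, IsTriangleOf n D U T p.1 j p.2 then
    if j ∈ D then
      ((bel n D U (h.choose.1, j) : ℝ) + 1) * ((bel n D U (j, h.choose.2) : ℝ) + 1)
    else
      ((n : ℝ) + 2) -
        (((n : ℝ) + 2) - (bel n D U (h.choose.1, j) : ℝ)) *
          (((n : ℝ) + 2) - (bel n D U (j, h.choose.2) : ℝ))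
  else 0

/-- Middle vertex of the triple `{a,b,c}` with `a < b` and `c ∉ {a,b}`. -/
def midOf (a b c : ℕ) : ℕ := if c < a then a else if c < b then c else b

/-- `c` is the third vertex of a triangle of `T` containing the diagonal `δ`. -/
def TriWith (n : ℕ) (D U : Finset ℕ) (T : Finset (ℕ × ℕ)) (δ : ℕ × ℕ) (c : ℕ) : Prop :=
  if c < δ.1 then IsTriangleOf n D U T c δ.1 δ.2
  else if c < δ.2 then IsTriangleOf n D U T δ.1 c δ.2
  else IsTriangleOf n D U T δ.1 δ.2 c

/-- `s_δ`: middle vertex of the triangle of `T` below `δ` (third vertex strictly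
inside the ccw arc from `δ.1` to `δ.2`). -/
def spineSrc (n : ℕ) (D U : Finset ℕ) (T : Finset (ℕ × ℕ)) (δ : ℕ × ℕ) : ℕ :=
  if h : ∃ c, StrictBetween n D U δ.1 δ.2 c ∧ TriWith n D U T δ c then
    midOf δ.1 δ.2 h.choose
  else 0

/-- `t_δ`: middle vertex of the triangle of `T` above `δ` (third vertex strictly
inside the ccw arc from `δ.2` to `δ.1`). -/
def spineTgt (n : ℕ) (D U : Finset ℕ) (T : Finset (ℕ × ℕ)) (δ : ℕ × ℕ) : ℕ :=
  if h : ∃ c, StrictBetween n D U δ.2 δ.1 c ∧ TriWith n D U T δ c then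
    midOf δ.1 δ.2 h.choose
  else 0

/-- `(p,q)` is an arc of the spine of `T`. -/
def SpineArc (n : ℕ) (D U : Finset ℕ) (T : Finset (ℕ × ℕ)) (p q : ℕ) : Prop :=
  ∃ δ ∈ T, spineSrc n D U T δ = p ∧ spineTgt n D U T δ = q

/-- The finite set of all triangulations of the polygon. -/
def allTri (n : ℕ) (D U : Finset ℕ) : Finset (Finset (ℕ × ℕ)) :=
  ((Finset.range (n + 3) ×ˢ Finset.range (n + 3)).filter
      (fun δ => IsInternalDiag n D U δ)).powerset.filter
    (fun T => IsTriangulation n D U T)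

end Spines

namespace Spines

/-- The labels of `[n+1]` are split into the down labels `D` and the up labels `U`. -/
structure LabelSplit (n : ℕ) (D U : Finset ℕ) : Prop where
  union : D ∪ U = Finset.Icc 1 (n + 1)
  disj : Disjoint D U

/-- The numbers `x`, `y`, `z` occur in this strict cyclic order. -/
def Cyc (x y z : ℕ) : Prop := x < y ∧ y < z ∨ y < z ∧ z < x ∨ z < x ∧ x < y

section Positions

variable {n : ℕ} {D U : Finset ℕ}

lemma LabelSplit.card_add (h : LabelSplit n D U) : D.card + U.card = n + 1 := by
  rw [← Finset.card_union_of_disjoint h.disj, h.union]; simp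

lemma LabelSplit.mem_or (h : LabelSplit n D U) {v : ℕ} (h0 : 0 < v) (h1 : v < n + 2) :
    v ∈ D ∨ v ∈ U := by
  rw [← Finset.mem_union, h.union, Finset.mem_Icc]; omega

lemma LabelSplit.bounds_of_mem_down (h : LabelSplit n D U) {v : ℕ} (hv : v ∈ D) :
    0 < v ∧ v < n + 2 ∧ v ∉ U := by
  have : v ∈ Finset.Icc 1 (n + 1) := by rw [← h.union]; exact Finset.mem_union_left _ hv
  rw [Finset.mem_Icc] at this
  exact ⟨by omega, by omega, Finset.disjoint_left.1 h.disj hv⟩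

lemma LabelSplit.bounds_of_mem_up (h : LabelSplit n D U) {v : ℕ} (hv : v ∈ U) :
    0 < v ∧ v < n + 2 ∧ v ∉ D := by
  have : v ∈ Finset.Icc 1 (n + 1) := by rw [← h.union]; exact Finset.mem_union_right _ hv
  rw [Finset.mem_Icc] at this
  exact ⟨by omega, by omega, Finset.disjoint_right.1 h.disj hv⟩

lemma pos_zero : pos n D U 0 = 0 := by simp [pos]

lemma pos_last : pos n D U (n + 2) = D.card + 1 := by simp [pos]

lemma LabelSplit.pos_down (h : LabelSplit n D U) {v : ℕ} (hv : v ∈ D) :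
    pos n D U v = 1 + (D.filter (fun d => d < v)).card := by
  have := h.bounds_of_mem_down hv
  rw [pos, if_neg (by omega), if_neg (by omega), if_pos hv]

lemma LabelSplit.pos_up (h : LabelSplit n D U) {v : ℕ} (hv : v ∈ U) :
    pos n D U v = D.card + 2 + (U.filter (fun u => v < u)).card := by
  have := h.bounds_of_mem_up hv
  rw [pos, if_neg (by omega), if_neg (by omega), if_neg this.2.2]

lemma LabelSplit.pos_down_bounds (h : LabelSplit n D U) {v : ℕ} (hv : v ∈ D) :
    0 < pos n D U v ∧ pos n D U v < D.card + 1 := by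
  have : (D.filter (fun d => d < v)).card < D.card :=
    Finset.card_lt_card (Finset.filter_ssubset.2 ⟨v, hv, lt_irrefl v⟩)
  rw [h.pos_down hv]; omega

lemma LabelSplit.pos_up_bounds (h : LabelSplit n D U) {v : ℕ} (hv : v ∈ U) :
    D.card + 1 < pos n D U v ∧ pos n D U v < n + 3 := by
  have : (U.filter (fun d => v < d)).card < U.card :=
    Finset.card_lt_card (Finset.filter_ssubset.2 ⟨v, hv, lt_irrefl v⟩)
  have := h.card_add
  rw [h.pos_up hv]; omega

lemma LabelSplit.pos_cases (h : LabelSplit n D U) {v : ℕ} (hv : v ≤ n + 2) :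
    (v = 0 ∧ pos n D U v = 0) ∨ (v = n + 2 ∧ pos n D U v = D.card + 1) ∨
    (v ∈ D ∧ 0 < pos n D U v ∧ pos n D U v < D.card + 1) ∨
    (v ∈ U ∧ D.card + 1 < pos n D U v ∧ pos n D U v < n + 3) := by
  rcases Nat.eq_zero_or_pos v with rfl | h0
  · exact Or.inl ⟨rfl, pos_zero⟩
  rcases hv.eq_or_lt with rfl | h1
  · exact Or.inr (Or.inl ⟨rfl, pos_last⟩)
  rcases h.mem_or h0 h1 with hD | hU
  · exact Or.inr (Or.inr (Or.inl ⟨hD, h.pos_down_bounds hD⟩))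
  · exact Or.inr (Or.inr (Or.inr ⟨hU, h.pos_up_bounds hU⟩))

lemma LabelSplit.pos_lt (h : LabelSplit n D U) {v : ℕ} (hv : v ≤ n + 2) :
    pos n D U v < n + 3 := by
  have := h.card_add
  rcases h.pos_cases hv with h | h | h | h <;> omega

/-- The lower boundary chain is traversed from left to right, the upper one from right
to left. -/
lemma LabelSplit.pos_of_lt (h : LabelSplit n D U) {a b : ℕ} (hab : a < b) (hb : b ≤ n + 2) :
    (pos n D U a ≤ D.card + 1 → pos n D U b ≤ D.card + 1 → pos n D U a < pos n D U b) ∧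
    (D.card + 1 ≤ pos n D U a → D.card + 1 ≤ pos n D U b → pos n D U b < pos n D U a) ∧
    pos n D U a ≠ D.card + 1 ∧ pos n D U b ≠ 0 := by
  rcases h.pos_cases (hab.le.trans hb) with ha' | ha' | ha' | ha' <;>
    rcases h.pos_cases hb with hb' | hb' | hb' | hb' <;> try omega
  · have : (D.filter (fun d => d < a)).card < (D.filter (fun d => d < b)).card := by
      apply Finset.card_lt_card
      refine Finset.ssubset_iff_of_subset (fun x hx => ?_) |>.2 ⟨a, ?_, ?_⟩
      · rw [Finset.mem_filter] at hx ⊢; exact ⟨hx.1, by omega⟩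
      · exact Finset.mem_filter.2 ⟨ha'.1, hab⟩
      · simp
    rw [h.pos_down ha'.1, h.pos_down hb'.1] at *
    omega
  · have : (U.filter (fun d => b < d)).card < (U.filter (fun d => a < d)).card := by
      apply Finset.card_lt_card
      refine Finset.ssubset_iff_of_subset (fun x hx => ?_) |>.2 ⟨b, ?_, ?_⟩
      · rw [Finset.mem_filter] at hx ⊢; exact ⟨hx.1, by omega⟩
      · exact Finset.mem_filter.2 ⟨hb'.1, hab⟩
      · simp
    rw [h.pos_up ha'.1, h.pos_up hb'.1] at *
    omega

lemma LabelSplit.pos_ne (h : LabelSplit n D U) {a b : ℕ} (ha : a ≤ n + 2) (hb : b ≤ n + 2)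
    (hab : a ≠ b) : pos n D U a ≠ pos n D U b := by
  rcases Nat.lt_or_gt_of_ne hab with hlt | hlt
  · have := h.pos_of_lt hlt hb; omega
  · have := h.pos_of_lt hlt ha; omega

lemma LabelSplit.exists_pos_eq (h : LabelSplit n D U) {p : ℕ} (hp : p < n + 3) :
    ∃ v ≤ n + 2, pos n D U v = p := by
  have hmaps : ∀ v ∈ Finset.range (n + 3), pos n D U v ∈ Finset.range (n + 3) := fun v hv => by
    rw [Finset.mem_range] at hv ⊢; exact h.pos_lt (by omega)
  have hinj : ∀ a ∈ Finset.range (n + 3), ∀ b ∈ Finset.range (n + 3),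
      pos n D U a = pos n D U b → a = b := fun a ha b hb hab => by
    rw [Finset.mem_range] at ha hb
    by_contra hne
    exact h.pos_ne (by omega) (by omega) hne hab
  obtain ⟨v, hv, hvp⟩ := Finset.surj_on_of_inj_on_of_card_le (fun v _ => pos n D U v) hmaps
    (fun a b ha hb => hinj a ha b hb) le_rfl p (Finset.mem_range.2 hp)
  exact ⟨v, by rw [Finset.mem_range] at hv; omega, hvp.symm⟩

lemma LabelSplit.relpos_eq (h : LabelSplit n D U) {a v : ℕ} (ha : a ≤ n + 2) (hv : v ≤ n + 2) :
    (pos n D U a ≤ pos n D U v ∧ relpos n D U a v = pos n D U v - pos n D U a) ∨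
    (pos n D U v < pos n D U a ∧
      relpos n D U a v = pos n D U v + (n + 3) - pos n D U a) := by
  have h1 := h.pos_lt ha
  have h2 := h.pos_lt hv
  rcases le_or_gt (pos n D U a) (pos n D U v) with hle | hlt
  · refine Or.inl ⟨hle, ?_⟩
    rw [relpos, show pos n D U v + (n + 3) - pos n D U a =
      (pos n D U v - pos n D U a) + (n + 3) by omega, Nat.add_mod_right,
      Nat.mod_eq_of_lt (by omega)]
  · exact Or.inr ⟨hlt, by rw [relpos, Nat.mod_eq_of_lt (by omega)]⟩

lemma LabelSplit.strictBetween_iff (h : LabelSplit n D U) {a b v : ℕ} (ha : a ≤ n + 2)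
    (hb : b ≤ n + 2) (hv : v ≤ n + 2) :
    StrictBetween n D U a b v ↔ Cyc (pos n D U a) (pos n D U v) (pos n D U b) := by
  have h1 := h.pos_lt ha
  have h2 := h.pos_lt hv
  have h3 := h.pos_lt hb
  have h4 := h.relpos_eq ha hv
  have h5 := h.relpos_eq ha hb
  simp only [StrictBetween, Cyc]
  omega

/-- Three vertices with middle vertex in `D` are in counterclockwise order. -/
lemma LabelSplit.cyc_down (h : LabelSplit n D U) {i j k : ℕ} (hij : i < j) (hjk : j < k)
    (hk : k ≤ n + 2) (hj : j ∈ D) : Cyc (pos n D U i) (pos n D U j) (pos n D U k) := by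
  have h1 := h.pos_of_lt hij (by omega)
  have h2 := h.pos_of_lt hjk hk
  have h3 := h.pos_of_lt (hij.trans hjk) hk
  have h4 := h.pos_down_bounds hj
  simp only [Cyc]
  omega

/-- Three vertices with middle vertex in `U` are in clockwise order. -/
lemma LabelSplit.cyc_up (h : LabelSplit n D U) {i j k : ℕ} (hij : i < j) (hjk : j < k)
    (hk : k ≤ n + 2) (hj : j ∈ U) : Cyc (pos n D U k) (pos n D U j) (pos n D U i) := by
  have h1 := h.pos_of_lt hij (by omega)
  have h2 := h.pos_of_lt hjk hk
  have h3 := h.pos_of_lt (hij.trans hjk) hk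
  have h4 := h.pos_up_bounds hj
  simp only [Cyc]
  omega

lemma Bel_subset (δ : ℕ × ℕ) : Bel n D U δ ⊆ Finset.Icc 1 (n + 1) := Finset.filter_subset _ _

lemma Abo_subset (δ : ℕ × ℕ) : Abo n D U δ ⊆ Finset.Icc 1 (n + 1) := Finset.sdiff_subset

lemma LabelSplit.mem_Bel (h : LabelSplit n D U) {a b v : ℕ} (ha : a ≤ n + 2) (hb : b ≤ n + 2)
    (hv : v ∈ Finset.Icc 1 (n + 1)) :
    v ∈ Bel n D U (a, b) ↔
      Cyc (pos n D U a) (pos n D U v) (pos n D U b) ∨ (v ∈ U ∧ (v = a ∨ v = b)) := by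
  have hv' := Finset.mem_Icc.1 hv
  rw [Bel, Finset.mem_filter, and_iff_right hv,
    h.strictBetween_iff ha hb (by omega)]

/-- Membership in `Bel` of the three sides of a triangle with middle vertex in `D`. -/
lemma LabelSplit.mem_Bel_down (h : LabelSplit n D U) {i j k : ℕ} (hij : i < j) (hjk : j < k)
    (hk : k ≤ n + 2) (hj : j ∈ D) {v : ℕ} (hv : v ∈ Finset.Icc 1 (n + 1)) :
    (v ∈ Bel n D U (i, k) ↔ v = j ∨ v ∈ Bel n D U (i, j) ∨ v ∈ Bel n D U (j, k)) ∧
    ¬ (v ∈ Bel n D U (i, j) ∧ v ∈ Bel n D U (j, k)) ∧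
    (v = j → v ∉ Bel n D U (i, j) ∧ v ∉ Bel n D U (j, k)) := by
  have hc := h.cyc_down hij hjk hk hj
  have hv' := Finset.mem_Icc.1 hv
  have hjU := (h.bounds_of_mem_down hj).2.2
  rw [h.mem_Bel (by omega) hk hv, h.mem_Bel (by omega) (by omega) hv,
    h.mem_Bel (by omega) hk hv]
  simp only [Cyc] at *
  by_cases h1 : v = i
  · subst h1; by_cases hU : v ∈ U <;> grind
  by_cases h2 : v = j
  · subst h2; grind
  by_cases h3 : v = k
  · subst h3; by_cases hU : v ∈ U <;> grind
  have e1 := h.pos_ne (a := v) (b := i) (by omega) (by omega) h1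
  have e2 := h.pos_ne (a := v) (b := j) (by omega) (by omega) h2
  have e3 := h.pos_ne (a := v) (b := k) (by omega) (by omega) h3
  simp only [h1, h2, h3, or_false, and_false, false_or]
  grind

/-- Membership in `Bel` of the three sides of a triangle with middle vertex in `U`. -/
lemma LabelSplit.mem_Bel_up (h : LabelSplit n D U) {i j k : ℕ} (hij : i < j) (hjk : j < k)
    (hk : k ≤ n + 2) (hj : j ∈ U) {v : ℕ} (hv : v ∈ Finset.Icc 1 (n + 1)) :
    (v ∉ Bel n D U (i, k) ↔ v = j ∨ v ∉ Bel n D U (i, j) ∨ v ∉ Bel n D U (j, k)) ∧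
    ¬ (v ∉ Bel n D U (i, j) ∧ v ∉ Bel n D U (j, k)) ∧
    (v = j → v ∈ Bel n D U (i, j) ∧ v ∈ Bel n D U (j, k)) := by
  have hc := h.cyc_up hij hjk hk hj
  have hv' := Finset.mem_Icc.1 hv
  rw [h.mem_Bel (by omega) hk hv, h.mem_Bel (by omega) (by omega) hv,
    h.mem_Bel (by omega) hk hv]
  simp only [Cyc] at *
  by_cases h1 : v = i
  · subst h1; by_cases hU : v ∈ U <;> grind
  by_cases h2 : v = j
  · subst h2; grind
  by_cases h3 : v = k
  · subst h3; by_cases hU : v ∈ U <;> grind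
  have e1 := h.pos_ne (a := v) (b := i) (by omega) (by omega) h1
  have e2 := h.pos_ne (a := v) (b := j) (by omega) (by omega) h2
  have e3 := h.pos_ne (a := v) (b := k) (by omega) (by omega) h3
  simp only [h1, h2, h3, or_false, and_false, false_or]
  grind

lemma LabelSplit.Bel_boundary (h : LabelSplit n D U) {a b : ℕ}
    (hab : IsBoundaryEdge n D U (a, b)) :
    Bel n D U (a, b) = ∅ ∨ Bel n D U (a, b) = Finset.Icc 1 (n + 1) := by
  obtain ⟨⟨hlt, hb⟩, hadj⟩ := hab
  simp only at hlt hb hadj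
  have h1 := h.pos_of_lt hlt hb
  have h2 := h.pos_lt hb
  have h3 := h.pos_lt (hlt.le.trans hb)
  have hcard := h.card_add
  rcases hadj with hadj | hadj
  · left
    rw [Finset.eq_empty_iff_forall_notMem]
    intro v hv
    have hvI := Bel_subset _ hv
    have hvI' := Finset.mem_Icc.1 hvI
    rw [h.mem_Bel (by omega) hb hvI] at hv
    have h4 := h.relpos_eq (hlt.le.trans hb) hb
    have h5 := h.pos_lt (v := v) (by omega)
    simp only [Cyc] at hv
    rcases hv with hv | ⟨hU, rfl | rfl⟩
    · omega
    · have := h.pos_up_bounds hU; omega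
    · have := h.pos_up_bounds hU; omega
  · right
    refine Finset.Subset.antisymm (Bel_subset _) fun v hvI => ?_
    have hvI' := Finset.mem_Icc.1 hvI
    rw [h.mem_Bel (by omega) hb hvI]
    have h4 := h.relpos_eq hb (hlt.le.trans hb)
    have h5 := h.pos_lt (v := v) (by omega)
    by_cases hva : v = a
    · subst hva
      rcases h.mem_or (v := v) (by omega) (by omega) with hD | hU
      · have := h.pos_down_bounds hD; omega
      · exact Or.inr ⟨hU, Or.inl rfl⟩
    by_cases hvb : v = b
    · subst hvb
      rcases h.mem_or (v := v) (by omega) (by omega) with hD | hU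
      · have := h.pos_down_bounds hD; omega
      · exact Or.inr ⟨hU, Or.inr rfl⟩
    have e1 := h.pos_ne (a := v) (b := a) (by omega) (by omega) hva
    have e2 := h.pos_ne (a := v) (b := b) (by omega) (by omega) hvb
    left
    simp only [Cyc]
    omega

end Positions

/-- `a` and `b`, in any order, are joined by a diagonal of `T` or a boundary edge. -/
def Joined (n : ℕ) (D U : Finset ℕ) (T : Finset (ℕ × ℕ)) (a b : ℕ) : Prop :=
  (a < b ∧ b ≤ n + 2 ∧ EdgeOf n D U T a b) ∨ (b < a ∧ a ≤ n + 2 ∧ EdgeOf n D U T b a)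

section Triangles

variable {n : ℕ} {D U : Finset ℕ} {T : Finset (ℕ × ℕ)}

lemma Joined.symm {a b : ℕ} (h : Joined n D U T a b) : Joined n D U T b a := Or.symm h

lemma Joined.bounds {a b : ℕ} (h : Joined n D U T a b) : a ≤ n + 2 ∧ b ≤ n + 2 ∧ a ≠ b := by
  rcases h with h | h <;> omega

lemma Joined.edgeOf {a b : ℕ} (h : Joined n D U T a b) (hab : a < b) : EdgeOf n D U T a b := by
  rcases h with h | h
  · exact h.2.2
  · omega

lemma Joined.cases {a b : ℕ} (h : Joined n D U T a b) :
    (a, b) ∈ T ∨ (b, a) ∈ T ∨ relpos n D U a b = 1 ∨ relpos n D U b a = 1 := by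
  rcases h with ⟨_, _, h | h⟩ | ⟨_, _, h | h⟩
  · exact Or.inl h
  · exact Or.inr (Or.inr h.2)
  · exact Or.inr (Or.inl h)
  · exact Or.inr (Or.inr h.2.symm)

lemma joined_of_relpos {a b : ℕ} (ha : a ≤ n + 2) (hb : b ≤ n + 2) (hab : a ≠ b)
    (h : relpos n D U a b = 1) : Joined n D U T a b := by
  rcases Nat.lt_or_gt_of_ne hab with hlt | hlt
  · exact Or.inl ⟨hlt, hb, Or.inr ⟨⟨hlt, hb⟩, Or.inl h⟩⟩
  · exact Or.inr ⟨hlt, ha, Or.inr ⟨⟨hlt, ha⟩, Or.inr h⟩⟩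

lemma joined_of_edgeOf {a b : ℕ} (hab : a < b) (hb : b ≤ n + 2) (h : EdgeOf n D U T a b) :
    Joined n D U T a b := Or.inl ⟨hab, hb, h⟩

lemma joined_of_mem (hT : IsTriangulation n D U T) {a b : ℕ} (h : (a, b) ∈ T) :
    Joined n D U T a b :=
  joined_of_edgeOf (hT.1 _ h).1.1 (hT.1 _ h).1.2 (Or.inl h)

lemma IsTriangleOf.joined {i j k : ℕ} (h : IsTriangleOf n D U T i j k) :
    Joined n D U T i j ∧ Joined n D U T j k ∧ Joined n D U T i k := by
  obtain ⟨hij, hjk, hk, h1, h2, h3⟩ := h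
  exact ⟨joined_of_edgeOf hij (by omega) h1, joined_of_edgeOf hjk hk h2,
    joined_of_edgeOf (by omega) hk h3⟩

lemma LabelSplit.not_cyc_of_relpos (h : LabelSplit n D U) {a b v : ℕ} (ha : a ≤ n + 2)
    (hb : b ≤ n + 2) (hv : v ≤ n + 2) (hab : relpos n D U a b = 1) :
    ¬ Cyc (pos n D U a) (pos n D U v) (pos n D U b) := by
  have p1 := h.pos_lt ha
  have p2 := h.pos_lt hb
  have p3 := h.pos_lt hv
  have r := h.relpos_eq ha hb
  simp only [Cyc]
  omega

/-- Edges of a triangulated polygon do not cross. -/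
lemma Joined.not_cross (h : LabelSplit n D U) (hT : IsTriangulation n D U T) {a b x y : ℕ}
    (hab : Joined n D U T a b) (hxy : Joined n D U T x y)
    (h1 : Cyc (pos n D U a) (pos n D U x) (pos n D U b))
    (h2 : Cyc (pos n D U b) (pos n D U y) (pos n D U a)) : False := by
  obtain ⟨ha, hb, hne⟩ := hab.bounds
  obtain ⟨hx, hy, hne'⟩ := hxy.bounds
  have c1 : Cyc (pos n D U x) (pos n D U b) (pos n D U y) := by
    simp only [Cyc] at *; omega
  have c2 : Cyc (pos n D U y) (pos n D U a) (pos n D U x) := by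
    simp only [Cyc] at *; omega
  have hax : a ≠ x := by rintro rfl; simp only [Cyc] at h1; omega
  have hbx : b ≠ x := by rintro rfl; simp only [Cyc] at h1; omega
  have hay : a ≠ y := by rintro rfl; simp only [Cyc] at h2; omega
  have hby : b ≠ y := by rintro rfl; simp only [Cyc] at h2; omega
  have s1 := (h.strictBetween_iff ha hb hx).2 h1
  have s2 := (h.strictBetween_iff hb ha hy).2 h2
  have key := hT.2.1
  rcases hab.cases with e | e | e | e
  · rcases hxy.cases with f | f | f | f
    · exact key _ e _ f ⟨hne, hne', hax, hay, hbx, hby, Or.inl ⟨s1, s2⟩⟩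
    · exact key _ e _ f ⟨hne, hne'.symm, hay, hax, hby, hbx, Or.inr ⟨s1, s2⟩⟩
    · exact h.not_cyc_of_relpos hx hy hb f c1
    · exact h.not_cyc_of_relpos hy hx ha f c2
  · rcases hxy.cases with f | f | f | f
    · exact key _ e _ f ⟨hne.symm, hne', hbx, hby, hax, hay, Or.inr ⟨s2, s1⟩⟩
    · exact key _ e _ f ⟨hne.symm, hne'.symm, hby, hbx, hay, hax, Or.inl ⟨s2, s1⟩⟩
    · exact h.not_cyc_of_relpos hx hy hb f c1
    · exact h.not_cyc_of_relpos hy hx ha f c2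
  · exact h.not_cyc_of_relpos ha hb hx e h1
  · exact h.not_cyc_of_relpos hb ha hy e h2

/-- A pair of vertices which is not an edge is crossed by an edge. -/
lemma exists_joined_crossing (h : LabelSplit n D U) (hT : IsTriangulation n D U T) {a b : ℕ}
    (ha : a ≤ n + 2) (hb : b ≤ n + 2) (hne : a ≠ b) (hab : ¬ Joined n D U T a b) :
    ∃ x y, Joined n D U T x y ∧ Cyc (pos n D U a) (pos n D U x) (pos n D U b) ∧
      Cyc (pos n D U b) (pos n D U y) (pos n D U a) := by
  wlog hlt : a < b generalizing a b
  · obtain ⟨x, y, hxy, h1, h2⟩ := this hb ha hne.symm (fun hj => hab hj.symm) (by omega)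
    exact ⟨y, x, hxy.symm, h2, h1⟩
  have hnT : (a, b) ∉ T := fun hm => hab (joined_of_mem hT hm)
  have hnB : ¬ IsBoundaryEdge n D U (a, b) := fun hm =>
    hab (joined_of_edgeOf hlt hb (Or.inr hm))
  obtain ⟨⟨x, y⟩, hxyT, hcross⟩ := hT.2.2 (a, b) ⟨⟨hlt, hb⟩, hnB⟩ hnT
  have hj := joined_of_mem hT hxyT
  obtain ⟨hx, hy, -⟩ := hj.bounds
  obtain ⟨-, -, -, -, -, -, ⟨s1, s2⟩ | ⟨s1, s2⟩⟩ := hcross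
  · exact ⟨x, y, hj, (h.strictBetween_iff ha hb hx).1 s1, (h.strictBetween_iff hb ha hy).1 s2⟩
  · exact ⟨y, x, hj.symm, (h.strictBetween_iff ha hb hy).1 s1,
      (h.strictBetween_iff hb ha hx).1 s2⟩

lemma exists_relpos_eq_one (h : LabelSplit n D U) {a : ℕ} (ha : a ≤ n + 2) :
    ∃ v ≤ n + 2, v ≠ a ∧ relpos n D U a v = 1 ∧
      (pos n D U v = pos n D U a + 1 ∨ pos n D U a = n + 2 ∧ pos n D U v = 0) := by
  have hlt := h.pos_lt ha
  by_cases hlast : pos n D U a = n + 2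
  · obtain ⟨v, hv, hpv⟩ := h.exists_pos_eq (p := 0) (by omega)
    have := h.relpos_eq ha hv
    exact ⟨v, hv, by rintro rfl; omega, by omega, by omega⟩
  · obtain ⟨v, hv, hpv⟩ := h.exists_pos_eq (p := pos n D U a + 1) (by omega)
    have := h.relpos_eq ha hv
    exact ⟨v, hv, by rintro rfl; omega, by omega, by omega⟩

/-- An edge has a triangle on each side which contains further vertices. -/
lemma Joined.exists_triangle (h : LabelSplit n D U) (hT : IsTriangulation n D U T) {a b : ℕ}
    (hab : Joined n D U T a b) (hr : relpos n D U a b ≠ 1) :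
    ∃ c, Cyc (pos n D U a) (pos n D U c) (pos n D U b) ∧
      Joined n D U T a c ∧ Joined n D U T c b := by
  obtain ⟨ha, hb, hne⟩ := hab.bounds
  have hpne := h.pos_ne ha hb hne
  have r0 := h.relpos_eq ha hb
  have p1 := h.pos_lt ha
  have p2 := h.pos_lt hb
  obtain ⟨v, hv, hva, hv1, -⟩ := exists_relpos_eq_one h ha
  set S := (Finset.range (n + 3)).filter
    (fun c => Joined n D U T a c ∧ relpos n D U a c < relpos n D U a b) with hS
  have hSne : S.Nonempty := by
    refine ⟨v, ?_⟩
    rw [hS, Finset.mem_filter, Finset.mem_range]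
    exact ⟨by omega, joined_of_relpos ha hv hva.symm hv1, by omega⟩
  obtain ⟨c, hcS, hmax⟩ := S.exists_max_image (relpos n D U a) hSne
  rw [hS, Finset.mem_filter, Finset.mem_range] at hcS
  obtain ⟨hc, hac, hcb⟩ := hcS
  have hc' : c ≤ n + 2 := by omega
  have r1 := h.relpos_eq ha hc'
  have p3 := h.pos_lt hc'
  have hpne' := h.pos_ne ha hc' hac.bounds.2.2
  have hcyc : Cyc (pos n D U a) (pos n D U c) (pos n D U b) := by
    simp only [Cyc]; omega
  refine ⟨c, hcyc, hac, ?_⟩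
  by_contra hncb
  have hcb' : c ≠ b := by rintro rfl; omega
  obtain ⟨x, y, hxy, h1, h2⟩ := exists_joined_crossing h hT hc' hb hcb' hncb
  obtain ⟨hx, hy, -⟩ := hxy.bounds
  have p4 := h.pos_lt hx
  have p5 := h.pos_lt hy
  by_cases hya : y = a
  · subst hya
    have r2 := h.relpos_eq ha hx
    have hxS : x ∈ S := by
      rw [hS, Finset.mem_filter, Finset.mem_range]
      refine ⟨by omega, hxy.symm, ?_⟩
      simp only [Cyc] at h1 hcyc; omega
    have := hmax x hxS
    simp only [Cyc] at h1 hcyc; omega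
  · have hpya := h.pos_ne hy ha hya
    by_cases hyc : Cyc (pos n D U a) (pos n D U y) (pos n D U c)
    · refine hac.not_cross h hT hxy.symm hyc ?_
      simp only [Cyc] at *; omega
    · refine hab.not_cross h hT hxy ?_ ?_ <;> simp only [Cyc] at * <;> omega

/-- On each side of an edge there is at most one triangle. -/
lemma triangle_apex_unique (h : LabelSplit n D U) (hT : IsTriangulation n D U T) {a b c c' : ℕ}
    (h1 : Cyc (pos n D U a) (pos n D U c) (pos n D U b))
    (h2 : Cyc (pos n D U a) (pos n D U c') (pos n D U b))
    (hac : Joined n D U T a c) (hcb : Joined n D U T c b)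
    (hac' : Joined n D U T a c') (hcb' : Joined n D U T c' b) : c = c' := by
  by_contra hne
  have hpne := h.pos_ne hac.bounds.2.1 hac'.bounds.2.1 hne
  by_cases h3 : Cyc (pos n D U a) (pos n D U c) (pos n D U c')
  · refine hac'.not_cross h hT hcb h3 ?_
    simp only [Cyc] at *; omega
  · refine hac.not_cross h hT (x := c') (y := b) hcb' ?_ ?_ <;> simp only [Cyc] at * <;> omega

/-- At a vertex `j`, at most one triangle separates a given pair of boundary directions. -/
lemma triangle_at_unique (h : LabelSplit n D U) (hT : IsTriangulation n D U T)
    {j p q p' q' : ℕ} (h1 : Cyc (pos n D U j) (pos n D U p) (pos n D U q'))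
    (h2 : Cyc (pos n D U j) (pos n D U p') (pos n D U q))
    (hjp : Joined n D U T j p) (hjq : Joined n D U T j q) (hpq : Joined n D U T p q)
    (hjp' : Joined n D U T j p') (hjq' : Joined n D U T j q') (hpq' : Joined n D U T p' q') :
    p = p' ∧ q = q' := by
  constructor
  · by_contra hne
    have hpne := h.pos_ne hjp.bounds.2.1 hjp'.bounds.2.1 hne
    by_cases h3 : Cyc (pos n D U j) (pos n D U p) (pos n D U p')
    · refine hjp'.not_cross h hT hpq h3 ?_
      simp only [Cyc] at *; omega
    · refine hjp.not_cross h hT hpq' ?_ ?_ <;> simp only [Cyc] at * <;> omega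
  · by_contra hne
    have hpne := h.pos_ne hjq.bounds.2.1 hjq'.bounds.2.1 hne
    by_cases h3 : Cyc (pos n D U j) (pos n D U q) (pos n D U q')
    · refine hjq.not_cross h hT hpq' ?_ ?_ <;> simp only [Cyc] at * <;> omega
    · refine hjq'.not_cross h hT hpq ?_ ?_ <;> simp only [Cyc] at * <;> omega

lemma IsTriangleOf.unique (h : LabelSplit n D U) (hT : IsTriangulation n D U T)
    {i j k i' k' : ℕ} (h1 : IsTriangleOf n D U T i j k) (h2 : IsTriangleOf n D U T i' j k') :
    i = i' ∧ k = k' := by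
  obtain ⟨a1, a2, a3⟩ := h1.joined
  obtain ⟨b1, b2, b3⟩ := h2.joined
  obtain ⟨hij, hjk, hk, -⟩ := h1
  obtain ⟨hij', hjk', hk', -⟩ := h2
  have rot {x y z : ℕ} (hc : Cyc x y z) : Cyc y z x := by simp only [Cyc] at *; omega
  rcases h.mem_or (v := j) (by omega) (by omega) with hj | hj
  · have := triangle_at_unique h hT (rot (h.cyc_down hij' hjk hk hj))
      (rot (h.cyc_down hij hjk' hk' hj)) a2 a1.symm a3.symm b2 b1.symm b3.symm
    exact ⟨this.2, this.1⟩
  · exact triangle_at_unique h hT (rot (h.cyc_up hij hjk' hk' hj))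
      (rot (h.cyc_up hij' hjk hk hj)) a1.symm a2 a3 b1.symm b2 b3

/-- Every label of `[n+1]` is the middle vertex of a triangle. -/
lemma exists_isTriangleOf (h : LabelSplit n D U) (hT : IsTriangulation n D U T) {j : ℕ}
    (h0 : 0 < j) (h1 : j < n + 2) : ∃ i k, IsTriangleOf n D U T i j k := by
  have hcard := h.card_add
  have hj : j ≤ n + 2 := by omega
  have pj := h.pos_lt hj
  obtain ⟨v, hv, hvj, hv1, hv2⟩ := exists_relpos_eq_one h hj
  rcases h.mem_or h0 h1 with hjD | hjU
  · have hjb := h.pos_down_bounds hjD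
    set S := (Finset.range (n + 3)).filter (fun c => Joined n D U T j c ∧ j < c) with hS
    have hSne : S.Nonempty := by
      refine ⟨v, ?_⟩
      rw [hS, Finset.mem_filter, Finset.mem_range]
      refine ⟨by omega, joined_of_relpos hj hv hvj.symm hv1, ?_⟩
      by_contra hlt
      have := h.pos_of_lt (a := v) (b := j) (by omega) hj
      omega
    obtain ⟨k, hkS, hmax⟩ := S.exists_max_image (relpos n D U j) hSne
    rw [hS, Finset.mem_filter, Finset.mem_range] at hkS
    obtain ⟨hk, hjk, hlt⟩ := hkS
    have hk' : k ≤ n + 2 := by omega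
    have pk := h.pos_lt hk'
    have c0 := h.cyc_down h0 hlt hk' hjD
    have p0 : pos n D U 0 = 0 := pos_zero
    have hr : relpos n D U k j ≠ 1 := by
      have := h.relpos_eq hk' hj
      simp only [Cyc] at c0; omega
    obtain ⟨i, hcyc, hki, hij⟩ := hjk.symm.exists_triangle h hT hr
    obtain ⟨-, hi, -⟩ := hki.bounds
    have hij' : i < j := by
      by_contra hle
      have hiS : i ∈ S := by
        rw [hS, Finset.mem_filter, Finset.mem_range]
        exact ⟨by omega, hij.symm, by have := hij.bounds; omega⟩
      have hmx := hmax i hiS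
      have r1 := h.relpos_eq hj hi
      have r2 := h.relpos_eq hj hk'
      have pi := h.pos_lt hi
      simp only [Cyc] at hcyc; omega
    exact ⟨i, k, hij', hlt, hk', hij.edgeOf hij', hjk.edgeOf hlt,
      hki.symm.edgeOf (hij'.trans hlt)⟩
  · have hjb := h.pos_up_bounds hjU
    set S := (Finset.range (n + 3)).filter (fun c => Joined n D U T j c ∧ c < j) with hS
    have hSne : S.Nonempty := by
      refine ⟨v, ?_⟩
      rw [hS, Finset.mem_filter, Finset.mem_range]
      refine ⟨by omega, joined_of_relpos hj hv hvj.symm hv1, ?_⟩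
      by_contra hlt
      have := h.pos_of_lt (a := j) (b := v) (by omega) hv
      omega
    obtain ⟨i, hiS, hmax⟩ := S.exists_max_image (relpos n D U j) hSne
    rw [hS, Finset.mem_filter, Finset.mem_range] at hiS
    obtain ⟨hi, hji, hlt⟩ := hiS
    have hi' : i ≤ n + 2 := by omega
    have pi := h.pos_lt hi'
    have c0 := h.cyc_up hlt h1 le_rfl hjU
    have p0 : pos n D U (n + 2) = D.card + 1 := pos_last
    have hr : relpos n D U i j ≠ 1 := by
      have := h.relpos_eq hi' hj
      simp only [Cyc] at c0; omega
    obtain ⟨k, hcyc, hik, hkj⟩ := hji.symm.exists_triangle h hT hr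
    obtain ⟨-, hk, -⟩ := hik.bounds
    have hjk' : j < k := by
      by_contra hle
      have hkS : k ∈ S := by
        rw [hS, Finset.mem_filter, Finset.mem_range]
        exact ⟨by omega, hkj.symm, by have := hkj.bounds; omega⟩
      have hmx := hmax k hkS
      have r1 := h.relpos_eq hj hi'
      have r2 := h.relpos_eq hj hk
      have pk := h.pos_lt hk
      simp only [Cyc] at hcyc; omega
    exact ⟨i, k, hlt, hjk', hk, hji.symm.edgeOf hlt, hkj.symm.edgeOf hjk',
      hik.edgeOf (hlt.trans hjk')⟩

end Triangles

section InitialSegments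

/-- `A` consists of the elements of `{1,…,m}` on which `τ` takes its smallest values. -/
def InitialSeg (m : ℕ) (τ : ℕ → ℕ) (A : Finset ℕ) : Prop :=
  ∀ x ∈ Finset.Icc 1 m, x ∈ A ↔ τ x ≤ A.card

variable {m : ℕ} {τ : ℕ → ℕ}

lemma initialSeg_empty (hτ : ∀ x ∈ Finset.Icc 1 m, τ x ∈ Finset.Icc 1 m) :
    InitialSeg m τ ∅ := fun x hx => by
  have := Finset.mem_Icc.1 (hτ x hx)
  simp; omega

lemma initialSeg_univ (hτ : ∀ x ∈ Finset.Icc 1 m, τ x ∈ Finset.Icc 1 m) :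
    InitialSeg m τ (Finset.Icc 1 m) := fun x hx => by
  have := Finset.mem_Icc.1 (hτ x hx)
  simp only [hx, Nat.card_Icc, true_iff]; omega

/-- Reversing `τ` exchanges initial segments and their complements. -/
lemma initialSeg_compl_iff (hτ : ∀ x ∈ Finset.Icc 1 m, τ x ∈ Finset.Icc 1 m) {A : Finset ℕ}
    (hA : A ⊆ Finset.Icc 1 m) :
    InitialSeg m (fun x => m + 1 - τ x) (Finset.Icc 1 m \ A) ↔ InitialSeg m τ A := by
  have hcard : (Finset.Icc 1 m \ A).card = m - A.card := by
    rw [Finset.card_sdiff_of_subset hA]; simp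
  have hle : A.card ≤ m := by simpa using Finset.card_le_card hA
  refine forall₂_congr fun x hx => ?_
  have := Finset.mem_Icc.1 (hτ x hx)
  rw [hcard, Finset.mem_sdiff, and_iff_right hx]
  by_cases hxA : x ∈ A <;> simp only [hxA, not_true_eq_false, not_false_eq_true, true_iff,
    false_iff] <;> omega

lemma InitialSeg.empty_or_empty {X Y : Finset ℕ} (hXI : X ⊆ Finset.Icc 1 m)
    (hYI : Y ⊆ Finset.Icc 1 m) (hXY : Disjoint X Y) (hX : InitialSeg m τ X)
    (hY : InitialSeg m τ Y) : X = ∅ ∨ Y = ∅ := by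
  by_contra! hne
  obtain ⟨⟨x, hx⟩, ⟨y, hy⟩⟩ := hne
  have h1 := (hX x (hXI hx)).1 hx
  have h2 := (hY y (hYI hy)).1 hy
  rcases le_total X.card Y.card with hle | hle
  · exact Finset.disjoint_left.1 hXY hx ((hY x (hXI hx)).2 (h1.trans hle))
  · exact Finset.disjoint_left.1 hXY ((hX y (hYI hy)).2 (h2.trans hle)) hy

variable {X Y : Finset ℕ} {j : ℕ}

lemma card_insert_union (hXY : Disjoint X Y) (hjX : j ∉ X) (hjY : j ∉ Y) :
    (insert j (X ∪ Y)).card = X.card + Y.card + 1 := by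
  rw [Finset.card_insert_of_notMem (by simp [hjX, hjY]), Finset.card_union_of_disjoint hXY]

/-- Adding one element of the right value extends an initial segment. -/
lemma InitialSeg.insert_iff (hτ : Set.InjOn τ (Finset.Icc 1 m)) (hj : j ∈ Finset.Icc 1 m)
    (hjX : j ∉ X) (hτj : τ j = X.card + 1) :
    InitialSeg m τ (insert j X) ↔ InitialSeg m τ X := by
  refine forall₂_congr fun x hx => ?_
  rw [Finset.card_insert_of_notMem hjX, Finset.mem_insert]
  by_cases hxj : x = j
  · subst hxj
    simp [hjX, hτj]
  · have : τ x ≠ X.card + 1 := fun he => hxj (hτ hx hj (he.trans hτj.symm))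
    have hle : τ x ≤ X.card + 1 ↔ τ x ≤ X.card := by omega
    simp only [hxj, false_or, hle]

lemma InitialSeg.insert_union (hτ : Set.InjOn τ (Finset.Icc 1 m)) (hXI : X ⊆ Finset.Icc 1 m)
    (hYI : Y ⊆ Finset.Icc 1 m) (hj : j ∈ Finset.Icc 1 m) (hXY : Disjoint X Y) (hjX : j ∉ X)
    (hjY : j ∉ Y) (hτj : τ j = (X.card + 1) * (Y.card + 1)) (hX : InitialSeg m τ X)
    (hY : InitialSeg m τ Y) : InitialSeg m τ (insert j (X ∪ Y)) := by
  rcases hX.empty_or_empty hXI hYI hXY hY with rfl | rfl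
  · rw [Finset.empty_union, InitialSeg.insert_iff hτ hj hjY (by simpa using hτj)]
    exact hY
  · rw [Finset.union_empty, InitialSeg.insert_iff hτ hj hjX (by simpa using hτj)]
    exact hX

lemma InitialSeg.of_insert_union (hτ : Set.InjOn τ (Finset.Icc 1 m))
    (hmaps : ∀ x ∈ Finset.Icc 1 m, τ x ∈ Finset.Icc 1 m) (hj : j ∈ Finset.Icc 1 m)
    (hXY : Disjoint X Y) (hjX : j ∉ X) (hjY : j ∉ Y)
    (hτj : τ j = (X.card + 1) * (Y.card + 1))
    (hW : InitialSeg m τ (insert j (X ∪ Y))) : InitialSeg m τ Y := by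
  rcases X.eq_empty_or_nonempty with rfl | hXne
  · rw [Finset.empty_union, InitialSeg.insert_iff hτ hj hjY (by simpa using hτj)] at hW
    exact hW
  rcases Y.eq_empty_or_nonempty with rfl | hYne
  · exact initialSeg_empty hmaps
  have h1 := (hW j hj).1 (Finset.mem_insert_self _ _)
  rw [card_insert_union hXY hjX hjY, hτj] at h1
  have h2 := Nat.mul_pos hXne.card_pos hYne.card_pos
  nlinarith

lemma InitialSeg.value (hXI : X ⊆ Finset.Icc 1 m) (hYI : Y ⊆ Finset.Icc 1 m)
    (hj : j ∈ Finset.Icc 1 m) (hXY : Disjoint X Y) (hjX : j ∉ X) (hjY : j ∉ Y)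
    (hX : InitialSeg m τ X) (hY : InitialSeg m τ Y)
    (hW : InitialSeg m τ (insert j (X ∪ Y))) :
    (X.card = 0 ∨ Y.card = 0) ∧ τ j = X.card + Y.card + 1 := by
  have h1 := (hW j hj).1 (Finset.mem_insert_self _ _)
  rw [card_insert_union hXY hjX hjY] at h1
  have h2 := mt (hX j hj).2 hjX
  have h3 := mt (hY j hj).2 hjY
  rcases hX.empty_or_empty hXI hYI hXY hY with rfl | rfl <;> simp at * <;> omega

lemma initialSeg_of_downClosed (hτ : Set.InjOn τ (Finset.Icc 1 m))
    (hmaps : ∀ x ∈ Finset.Icc 1 m, τ x ∈ Finset.Icc 1 m) {A : Finset ℕ}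
    (hA : A ⊆ Finset.Icc 1 m)
    (hdown : ∀ x ∈ A, ∀ y ∈ Finset.Icc 1 m, τ y < τ x → y ∈ A) : InitialSeg m τ A := by
  have hsurj := Finset.surj_on_of_inj_on_of_card_le (fun v _ => τ v) hmaps
    (fun a b ha hb hab => hτ ha hb hab) le_rfl
  have himg : (A.image τ).card = A.card :=
    Finset.card_image_of_injOn (hτ.mono (by exact_mod_cast hA))
  intro x hx
  have hx1 := Finset.mem_Icc.1 (hmaps x hx)
  constructor
  · intro hxA
    have hsub : Finset.Icc 1 (τ x) ⊆ A.image τ := fun b hb => by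
      have hb' := Finset.mem_Icc.1 hb
      obtain ⟨y, hy, rfl⟩ := hsurj b (Finset.mem_Icc.2 ⟨hb'.1, by omega⟩)
      refine Finset.mem_image_of_mem _ ?_
      rcases hb'.2.eq_or_lt with he | hlt
      · rwa [hτ hy hx he]
      · exact hdown x hxA y hy hlt
    have := Finset.card_le_card hsub
    rw [himg] at this
    simpa using this
  · intro hle
    by_contra hxA
    have hsub : A.image τ ⊆ Finset.Icc 1 (τ x - 1) := fun b hb => by
      obtain ⟨y, hy, rfl⟩ := Finset.mem_image.1 hb
      have hy1 := Finset.mem_Icc.1 (hmaps y (hA hy))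
      have hne : τ y ≠ τ x := fun he => hxA (hτ (hA hy) hx he ▸ hy)
      have : ¬ τ x < τ y := fun hlt => hxA (hdown y hy x hx hlt)
      exact Finset.mem_Icc.2 ⟨hy1.1, by omega⟩
    have := Finset.card_le_card hsub
    rw [himg] at this
    simp at this
    omega

end InitialSegments

section Spine

variable {n : ℕ} {D U : Finset ℕ} {T : Finset (ℕ × ℕ)}

lemma IsTriangleOf.mem_Icc {i j k : ℕ} (ht : IsTriangleOf n D U T i j k) :
    j ∈ Finset.Icc 1 (n + 1) := by
  obtain ⟨hij, hjk, hk, -⟩ := ht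
  exact Finset.mem_Icc.2 ⟨by omega, by omega⟩

/-- The sides `δ` of the triangle `i < j < k` which lie above it. -/
def IsUpperSide (D U : Finset ℕ) (i j k : ℕ) (δ : ℕ × ℕ) : Prop :=
  (j ∈ D ∧ δ = (i, k)) ∨ (j ∈ U ∧ (δ = (i, j) ∨ δ = (j, k)))

/-- The sides `δ` of the triangle `i < j < k` which lie below it. -/
def IsLowerSide (D U : Finset ℕ) (i j k : ℕ) (δ : ℕ × ℕ) : Prop :=
  (j ∈ U ∧ δ = (i, k)) ∨ (j ∈ D ∧ (δ = (i, j) ∨ δ = (j, k)))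

lemma IsUpperSide.mem_Bel (h : LabelSplit n D U) {i j k : ℕ} {δ : ℕ × ℕ}
    (ht : IsTriangleOf n D U T i j k) (hδ : IsUpperSide D U i j k δ) : j ∈ Bel n D U δ := by
  obtain ⟨hij, hjk, hk, -⟩ := id ht
  rcases hδ with ⟨hj, rfl⟩ | ⟨hj, rfl | rfl⟩
  · exact (h.mem_Bel_down hij hjk hk hj ht.mem_Icc).1.2 (Or.inl rfl)
  · exact ((h.mem_Bel_up hij hjk hk hj ht.mem_Icc).2.2 rfl).1
  · exact ((h.mem_Bel_up hij hjk hk hj ht.mem_Icc).2.2 rfl).2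

lemma IsLowerSide.notMem_Bel (h : LabelSplit n D U) {i j k : ℕ} {δ : ℕ × ℕ}
    (ht : IsTriangleOf n D U T i j k) (hδ : IsLowerSide D U i j k δ) : j ∉ Bel n D U δ := by
  obtain ⟨hij, hjk, hk, -⟩ := id ht
  rcases hδ with ⟨hj, rfl⟩ | ⟨hj, rfl | rfl⟩
  · exact (h.mem_Bel_up hij hjk hk hj ht.mem_Icc).1.2 (Or.inl rfl)
  · exact ((h.mem_Bel_down hij hjk hk hj ht.mem_Icc).2.2 rfl).1
  · exact ((h.mem_Bel_down hij hjk hk hj ht.mem_Icc).2.2 rfl).2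

lemma triWith_of_joined {a b c : ℕ} (hlt : a < b) (hab : Joined n D U T a b)
    (hac : Joined n D U T a c) (hcb : Joined n D U T c b) : TriWith n D U T (a, b) c := by
  have h1 := hab.bounds
  have h2 := hac.bounds
  have h3 := hcb.bounds
  simp only [TriWith]
  split_ifs with hc hc'
  · exact ⟨hc, hlt, h1.2.1, hac.symm.edgeOf hc, hab.edgeOf hlt, hcb.edgeOf (hc.trans hlt)⟩
  · have hac' : a < c := by omega
    exact ⟨hac', hc', h1.2.1, hac.edgeOf hac', hcb.edgeOf hc', hab.edgeOf hlt⟩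
  · have hbc : b < c := by omega
    exact ⟨hlt, hbc, h2.2.1, hab.edgeOf hlt, hcb.symm.edgeOf hbc, hac.edgeOf (hlt.trans hbc)⟩

lemma IsTriangulation.relpos_ne_one (hT : IsTriangulation n D U T) {δ : ℕ × ℕ} (hδ : δ ∈ T) :
    relpos n D U δ.1 δ.2 ≠ 1 ∧ relpos n D U δ.2 δ.1 ≠ 1 := by
  obtain ⟨hd, hb⟩ := hT.1 δ hδ
  exact ⟨fun he => hb ⟨hd, Or.inl he⟩, fun he => hb ⟨hd, Or.inr he⟩⟩

lemma spineSrc_spec (h : LabelSplit n D U) (hT : IsTriangulation n D U T) {δ : ℕ × ℕ}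
    (hδ : δ ∈ T) : ∃ i j k, spineSrc n D U T δ = j ∧ IsTriangleOf n D U T i j k ∧
      IsUpperSide D U i j k δ := by
  obtain ⟨a, b⟩ := δ
  obtain ⟨hlt, hb⟩ := (hT.1 _ hδ).1
  simp only at hlt hb
  have ha : a ≤ n + 2 := by omega
  have hab := joined_of_mem hT hδ
  have hex : ∃ c, StrictBetween n D U a b c ∧ TriWith n D U T (a, b) c := by
    obtain ⟨c, hcyc, hac, hcb⟩ := hab.exists_triangle h hT (hT.relpos_ne_one hδ).1
    exact ⟨c, (h.strictBetween_iff ha hb hac.bounds.2.1).2 hcyc,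
      triWith_of_joined hlt hab hac hcb⟩
  have hdef : spineSrc n D U T (a, b) = midOf a b hex.choose := by
    rw [spineSrc, dif_pos hex]
  rw [hdef]
  generalize hc : hex.choose = c
  have hspec := hex.choose_spec
  rw [hc] at hspec
  obtain ⟨hsb, htri⟩ := hspec
  have hcn : c ≤ n + 2 := hsb.1
  rw [h.strictBetween_iff ha hb hcn] at hsb
  simp only [TriWith] at htri
  simp only [midOf]
  split_ifs at htri ⊢ with h1 h2
  · refine ⟨c, a, b, rfl, htri, Or.inr ⟨?_, Or.inr rfl⟩⟩
    refine (h.mem_or (by omega) (by omega)).resolve_left fun hD => ?_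
    have := h.cyc_down h1 hlt hb hD
    simp only [Cyc] at *; omega
  · have hac : a < c := htri.1
    refine ⟨a, c, b, rfl, htri, Or.inl ⟨?_, rfl⟩⟩
    refine (h.mem_or (by omega) (by omega)).resolve_right fun hU => ?_
    have := h.cyc_up hac h2 hb hU
    simp only [Cyc] at *; omega
  · have hbc : b < c := htri.2.1
    refine ⟨a, b, c, rfl, htri, Or.inr ⟨?_, Or.inl rfl⟩⟩
    refine (h.mem_or (by omega) (by omega)).resolve_left fun hD => ?_
    have := h.cyc_down hlt hbc hcn hD
    simp only [Cyc] at *; omega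

lemma spineTgt_spec (h : LabelSplit n D U) (hT : IsTriangulation n D U T) {δ : ℕ × ℕ}
    (hδ : δ ∈ T) : ∃ i j k, spineTgt n D U T δ = j ∧ IsTriangleOf n D U T i j k ∧
      IsLowerSide D U i j k δ := by
  obtain ⟨a, b⟩ := δ
  obtain ⟨hlt, hb⟩ := (hT.1 _ hδ).1
  simp only at hlt hb
  have ha : a ≤ n + 2 := by omega
  have hab := joined_of_mem hT hδ
  have hex : ∃ c, StrictBetween n D U b a c ∧ TriWith n D U T (a, b) c := by
    obtain ⟨c, hcyc, hbc, hca⟩ := hab.symm.exists_triangle h hT (hT.relpos_ne_one hδ).2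
    exact ⟨c, (h.strictBetween_iff hb ha hbc.bounds.2.1).2 hcyc,
      triWith_of_joined hlt hab hca.symm hbc.symm⟩
  have hdef : spineTgt n D U T (a, b) = midOf a b hex.choose := by
    rw [spineTgt, dif_pos hex]
  rw [hdef]
  generalize hc : hex.choose = c
  have hspec := hex.choose_spec
  rw [hc] at hspec
  obtain ⟨hsb, htri⟩ := hspec
  have hcn : c ≤ n + 2 := hsb.1
  rw [h.strictBetween_iff hb ha hcn] at hsb
  simp only [TriWith] at htri
  simp only [midOf]
  split_ifs at htri ⊢ with h1 h2
  · refine ⟨c, a, b, rfl, htri, Or.inr ⟨?_, Or.inr rfl⟩⟩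
    refine (h.mem_or (by omega) (by omega)).resolve_right fun hU => ?_
    have := h.cyc_up h1 hlt hb hU
    simp only [Cyc] at *; omega
  · have hac : a < c := htri.1
    refine ⟨a, c, b, rfl, htri, Or.inl ⟨?_, rfl⟩⟩
    refine (h.mem_or (by omega) (by omega)).resolve_left fun hD => ?_
    have := h.cyc_down hac h2 hb hD
    simp only [Cyc] at *; omega
  · have hbc : b < c := htri.2.1
    refine ⟨a, b, c, rfl, htri, Or.inr ⟨?_, Or.inl rfl⟩⟩
    refine (h.mem_or (by omega) (by omega)).resolve_right fun hU => ?_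
    have := h.cyc_up hlt hbc hcn hU
    simp only [Cyc] at *; omega

/-- The third vertex of a triangle lies above each of its lower sides. -/
lemma IsLowerSide.exists_apex (h : LabelSplit n D U) {i j k a b : ℕ}
    (ht : IsTriangleOf n D U T i j k) (hδ : IsLowerSide D U i j k (a, b)) :
    ∃ c, Cyc (pos n D U b) (pos n D U c) (pos n D U a) ∧ Joined n D U T b c ∧
      Joined n D U T c a ∧ j = midOf a b c := by
  obtain ⟨e1, e2, e3⟩ := ht.joined
  obtain ⟨hij, hjk, hk, -⟩ := ht
  rcases hδ with ⟨hj, he⟩ | ⟨hj, he | he⟩ <;> obtain ⟨rfl, rfl⟩ := Prod.mk.inj he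
  · refine ⟨j, h.cyc_up hij hjk hk hj, e2.symm, e1.symm, ?_⟩
    rw [midOf, if_neg (by omega), if_pos hjk]
  · refine ⟨k, ?_, e2, e3.symm, ?_⟩
    · have := h.cyc_down hij hjk hk hj
      simp only [Cyc] at *; omega
    · rw [midOf, if_neg (by omega), if_neg (by omega)]
  · refine ⟨i, ?_, e3.symm, e1, ?_⟩
    · have := h.cyc_down hij hjk hk hj
      simp only [Cyc] at *; omega
    · rw [midOf, if_pos hij]

lemma spineTgt_eq (h : LabelSplit n D U) (hT : IsTriangulation n D U T) {i j k : ℕ}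
    {δ : ℕ × ℕ} (hδ : δ ∈ T) (ht : IsTriangleOf n D U T i j k)
    (hl : IsLowerSide D U i j k δ) : spineTgt n D U T δ = j := by
  obtain ⟨i', j', k', hj', ht', hl'⟩ := spineTgt_spec h hT hδ
  obtain ⟨c, c1, c2, c3, c4⟩ := hl.exists_apex h ht
  obtain ⟨c', c1', c2', c3', c4'⟩ := hl'.exists_apex h ht'
  rw [hj', c4, c4', triangle_apex_unique h hT c1 c1' c2 c3 c2' c3']

/-- A triangle whose middle vertex lies below an edge lies entirely below this edge. -/
lemma IsTriangleOf.not_above (h : LabelSplit n D U) (hT : IsTriangulation n D U T)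
    {i j k a b v : ℕ} (ht : IsTriangleOf n D U T i j k) (hab : a < b)
    (he : Joined n D U T a b) (hj : j ∈ Bel n D U (a, b)) (hv : v = i ∨ v = j ∨ v = k) :
    ¬ Cyc (pos n D U b) (pos n D U v) (pos n D U a) := by
  have hjI := ht.mem_Icc
  obtain ⟨e1, e2, e3⟩ := ht.joined
  obtain ⟨hij, hjk, hk, -⟩ := ht
  obtain ⟨ha, hb, -⟩ := he.bounds
  rw [h.mem_Bel ha hb hjI] at hj
  have hi : i ≤ n + 2 := by omega
  have hij' : j ≤ n + 2 := by omega
  intro hc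
  rcases hj with hj | ⟨hjU, rfl | rfl⟩
  · rcases hv with rfl | rfl | rfl
    · exact he.not_cross h hT e1.symm hj hc
    · simp only [Cyc] at *; omega
    · exact he.not_cross h hT e2 hj hc
  · have c1 := h.cyc_up hij hab hb hjU
    rcases hv with rfl | rfl | rfl
    · simp only [Cyc] at *; omega
    · simp only [Cyc] at *; omega
    · refine he.not_cross h hT e3 ?_ hc
      simp only [Cyc] at *; omega
  · have c1 := h.cyc_up hab hjk hk hjU
    rcases hv with rfl | rfl | rfl
    · refine he.not_cross h hT e3.symm ?_ hc
      simp only [Cyc] at *; omega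
    · simp only [Cyc] at *; omega
    · simp only [Cyc] at *; omega

/-- A triangle whose middle vertex lies above an edge lies entirely above this edge. -/
lemma IsTriangleOf.not_below (h : LabelSplit n D U) (hT : IsTriangulation n D U T)
    {i j k a b v : ℕ} (ht : IsTriangleOf n D U T i j k) (hab : a < b)
    (he : Joined n D U T a b) (hj : j ∉ Bel n D U (a, b)) (hv : v = i ∨ v = j ∨ v = k) :
    ¬ Cyc (pos n D U a) (pos n D U v) (pos n D U b) := by
  have hjI := ht.mem_Icc
  obtain ⟨e1, e2, e3⟩ := ht.joined
  obtain ⟨hij, hjk, hk, -⟩ := ht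
  obtain ⟨ha, hb, -⟩ := he.bounds
  rw [h.mem_Bel ha hb hjI, not_or, not_and_or] at hj
  obtain ⟨hj, hj'⟩ := hj
  have hi : i ≤ n + 2 := by omega
  have hij' : j ≤ n + 2 := by omega
  intro hc
  by_cases hja : j = a
  · subst hja
    have hjD : j ∈ D := (h.mem_or (by omega) (by omega)).resolve_right fun hU => by simp_all
    have c1 := h.cyc_down hij hab hb hjD
    rcases hv with rfl | rfl | rfl
    · simp only [Cyc] at *; omega
    · simp only [Cyc] at *; omega
    · refine he.not_cross h hT e3.symm hc ?_
      simp only [Cyc] at *; omega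
  by_cases hjb : j = b
  · subst hjb
    have hjD : j ∈ D := (h.mem_or (by omega) (by omega)).resolve_right fun hU => by simp_all
    have c1 := h.cyc_down hab hjk hk hjD
    rcases hv with rfl | rfl | rfl
    · refine he.not_cross h hT e3 hc ?_
      simp only [Cyc] at *; omega
    · simp only [Cyc] at *; omega
    · simp only [Cyc] at *; omega
  have p1 := h.pos_ne hij' ha hja
  have p2 := h.pos_ne hij' hb hjb
  have hj2 : Cyc (pos n D U b) (pos n D U j) (pos n D U a) := by
    simp only [Cyc] at *; omega
  rcases hv with rfl | rfl | rfl
  · exact he.not_cross h hT e1 hc hj2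
  · exact hj hc
  · exact he.not_cross h hT e2.symm hc hj2

lemma IsUpperSide.vertices {i j k : ℕ} {δ : ℕ × ℕ} (hδ : IsUpperSide D U i j k δ) :
    (δ.1 = i ∨ δ.1 = j ∨ δ.1 = k) ∧ (δ.2 = i ∨ δ.2 = j ∨ δ.2 = k) := by
  rcases hδ with ⟨-, rfl⟩ | ⟨-, rfl | rfl⟩ <;> simp

lemma IsLowerSide.vertices {i j k : ℕ} {δ : ℕ × ℕ} (hδ : IsLowerSide D U i j k δ) :
    (δ.1 = i ∨ δ.1 = j ∨ δ.1 = k) ∧ (δ.2 = i ∨ δ.2 = j ∨ δ.2 = k) := by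
  rcases hδ with ⟨-, rfl⟩ | ⟨-, rfl | rfl⟩ <;> simp

/-- The labels below an edge are closed under predecessors in the spine. -/
lemma SpineArc.mem_Bel (h : LabelSplit n D U) (hT : IsTriangulation n D U T) {p q a b : ℕ}
    (harc : SpineArc n D U T p q) (hab : a < b) (he : Joined n D U T a b)
    (hq : q ∈ Bel n D U (a, b)) : p ∈ Bel n D U (a, b) := by
  obtain ⟨δ, hδ, rfl, rfl⟩ := harc
  obtain ⟨i, j, k, hj, ht, hs⟩ := spineSrc_spec h hT hδ
  obtain ⟨i', j', k', hj', ht', hs'⟩ := spineTgt_spec h hT hδ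
  rw [hj'] at hq
  rw [hj]
  by_contra hp
  obtain ⟨c, d⟩ := δ
  obtain ⟨ha, hb, -⟩ := he.bounds
  obtain ⟨hc, hd, hcd⟩ := (joined_of_mem hT hδ).bounds
  have hlt : c < d := (hT.1 _ hδ).1.1
  have key : ∀ v, (v = i ∨ v = j ∨ v = k) → (v = i' ∨ v = j' ∨ v = k') → v ≤ n + 2 →
      v = a ∨ v = b := by
    intro v h1 h2 hv
    have f1 := ht.not_below h hT hab he hp h1
    have f2 := ht'.not_above h hT hab he hq h2
    by_contra! hne
    have p1 := h.pos_ne hv ha hne.1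
    have p2 := h.pos_ne hv hb hne.2
    have p3 := h.pos_ne ha hb hab.ne
    simp only [Cyc] at *; omega
  have k1 := key c hs.vertices.1 hs'.vertices.1 hc
  have k2 := key d hs.vertices.2 hs'.vertices.2 hd
  obtain ⟨rfl, rfl⟩ : c = a ∧ d = b := by omega
  exact hp (hs.mem_Bel h ht)

end Spine

section Equivalences

variable {n : ℕ} {D U : Finset ℕ} {T : Finset (ℕ × ℕ)}

lemma card_Abo (δ : ℕ × ℕ) : (Abo n D U δ).card + bel n D U δ = n + 1 := by
  have := Finset.card_sdiff_add_card_eq_card (Bel_subset (n := n) (D := D) (U := U) δ)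
  simpa [Abo, bel] using this

lemma IsTriangleOf.Bel_eq (h : LabelSplit n D U) {i j k : ℕ} (ht : IsTriangleOf n D U T i j k)
    (hj : j ∈ D) :
    Bel n D U (i, k) = insert j (Bel n D U (i, j) ∪ Bel n D U (j, k)) ∧
    Disjoint (Bel n D U (i, j)) (Bel n D U (j, k)) ∧
    j ∉ Bel n D U (i, j) ∧ j ∉ Bel n D U (j, k) := by
  have hjI := ht.mem_Icc
  obtain ⟨hij, hjk, hk, -⟩ := ht
  refine ⟨Finset.ext fun v => ?_, Finset.disjoint_left.2 fun v hv hv' => ?_,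
    (h.mem_Bel_down hij hjk hk hj hjI).2.2 rfl⟩
  · rw [Finset.mem_insert, Finset.mem_union]
    by_cases hv : v ∈ Finset.Icc 1 (n + 1)
    · exact (h.mem_Bel_down hij hjk hk hj hv).1
    · have hne : v ≠ j := by rintro rfl; exact hv hjI
      have key : ∀ δ, v ∉ Bel n D U δ := fun δ hδ => hv (Bel_subset δ hδ)
      simp [hne, key]
  · exact (h.mem_Bel_down hij hjk hk hj (Bel_subset _ hv)).2.1 ⟨hv, hv'⟩

lemma IsTriangleOf.Abo_eq (h : LabelSplit n D U) {i j k : ℕ} (ht : IsTriangleOf n D U T i j k)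
    (hj : j ∈ U) :
    Abo n D U (i, k) = insert j (Abo n D U (i, j) ∪ Abo n D U (j, k)) ∧
    Disjoint (Abo n D U (i, j)) (Abo n D U (j, k)) ∧
    j ∉ Abo n D U (i, j) ∧ j ∉ Abo n D U (j, k) := by
  have hjI := ht.mem_Icc
  obtain ⟨hij, hjk, hk, -⟩ := ht
  have hjB := (h.mem_Bel_up hij hjk hk hj hjI).2.2 rfl
  refine ⟨Finset.ext fun v => ?_, Finset.disjoint_left.2 fun v hv hv' => ?_, ?_, ?_⟩
  · rw [Finset.mem_insert, Finset.mem_union]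
    by_cases hv : v ∈ Finset.Icc 1 (n + 1)
    · have := (h.mem_Bel_up hij hjk hk hj hv).1
      simpa only [Abo, Finset.mem_sdiff, hv, true_and] using this
    · have hne : v ≠ j := by rintro rfl; exact hv hjI
      have key : ∀ δ, v ∉ Abo n D U δ := fun δ hδ => hv (Abo_subset δ hδ)
      simp [hne, key]
  · rw [Abo, Finset.mem_sdiff] at hv hv'
    exact (h.mem_Bel_up hij hjk hk hj hv.1).2.1 ⟨hv.2, hv'.2⟩
  · simp [Abo, hjB.1]
  · simp [Abo, hjB.2]

lemma xcoord_eq_down (h : LabelSplit n D U) (hT : IsTriangulation n D U T) {i j k : ℕ}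
    (ht : IsTriangleOf n D U T i j k) (hj : j ∈ D) (s : ℕ) :
    xcoord n D U T j = (s : ℝ) ↔ s = (bel n D U (i, j) + 1) * (bel n D U (j, k) + 1) := by
  have hex : ∃ p : ℕ × ℕ, IsTriangleOf n D U T p.1 j p.2 := ⟨(i, k), ht⟩
  obtain ⟨h1, h2⟩ := hex.choose_spec.unique h hT ht
  rw [xcoord, dif_pos hex, if_pos hj, h1, h2, eq_comm]
  norm_cast

lemma xcoord_eq_up (h : LabelSplit n D U) (hT : IsTriangulation n D U T) {i j k : ℕ}
    (ht : IsTriangleOf n D U T i j k) (hj : j ∈ U) {s : ℕ} (hs : s ≤ n + 1) :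
    xcoord n D U T j = (s : ℝ) ↔
      n + 1 + 1 - s = ((Abo n D U (i, j)).card + 1) * ((Abo n D U (j, k)).card + 1) := by
  have hex : ∃ p : ℕ × ℕ, IsTriangleOf n D U T p.1 j p.2 := ⟨(i, k), ht⟩
  obtain ⟨h1, h2⟩ := hex.choose_spec.unique h hT ht
  have hjD := (h.bounds_of_mem_up hj).2.2
  rw [xcoord, dif_pos hex, if_neg hjD, h1, h2]
  have c1 : ((Abo n D U (i, j)).card : ℝ) + bel n D U (i, j) = n + 1 := by
    exact_mod_cast card_Abo (n := n) (D := D) (U := U) (i, j)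
  have c2 : ((Abo n D U (j, k)).card : ℝ) + bel n D U (j, k) = n + 1 := by
    exact_mod_cast card_Abo (n := n) (D := D) (U := U) (j, k)
  rw [← @Nat.cast_inj ℝ, Nat.cast_sub (by omega)]
  push_cast
  rw [show ((n : ℝ) + 2 - bel n D U (i, j)) = (Abo n D U (i, j)).card + 1 by linarith,
    show ((n : ℝ) + 2 - bel n D U (j, k)) = (Abo n D U (j, k)).card + 1 by linarith]
  constructor <;> intro he <;> linarith

variable {σ : ℕ → ℕ}

/-- The labels below every edge of the triangulated polygon are an initial segment for `σ`. -/
def AllInitial (n : ℕ) (D U : Finset ℕ) (T : Finset (ℕ × ℕ)) (σ : ℕ → ℕ) : Prop :=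
  ∀ a b, a < b → Joined n D U T a b → InitialSeg (n + 1) σ (Bel n D U (a, b))

lemma reverse_maps (hσ : ∀ j ∈ Finset.Icc 1 (n + 1), σ j ∈ Finset.Icc 1 (n + 1)) :
    ∀ j ∈ Finset.Icc 1 (n + 1), n + 1 + 1 - σ j ∈ Finset.Icc 1 (n + 1) := fun j hj => by
  have := Finset.mem_Icc.1 (hσ j hj)
  exact Finset.mem_Icc.2 ⟨by omega, by omega⟩

lemma reverse_injOn (hσ : ∀ j ∈ Finset.Icc 1 (n + 1), σ j ∈ Finset.Icc 1 (n + 1))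
    (hinj : Set.InjOn σ (Finset.Icc 1 (n + 1))) :
    Set.InjOn (fun j => n + 1 + 1 - σ j) (Finset.Icc 1 (n + 1)) := fun x hx y hy hxy => by
  have h1 := Finset.mem_Icc.1 (hσ x hx)
  have h2 := Finset.mem_Icc.1 (hσ y hy)
  exact hinj hx hy (by simp only at hxy; omega)

/-- Under the coordinate equation at the middle vertex, if two sides of a triangle have initial
segments below them, then so has the third. -/
lemma IsTriangleOf.initialSeg_sides (h : LabelSplit n D U) (hT : IsTriangulation n D U T)
    (hσ : ∀ j ∈ Finset.Icc 1 (n + 1), σ j ∈ Finset.Icc 1 (n + 1))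
    (hinj : Set.InjOn σ (Finset.Icc 1 (n + 1))) {i j k : ℕ} (ht : IsTriangleOf n D U T i j k)
    (hx : xcoord n D U T j = (σ j : ℝ)) :
    (InitialSeg (n + 1) σ (Bel n D U (i, j)) → InitialSeg (n + 1) σ (Bel n D U (j, k)) →
      InitialSeg (n + 1) σ (Bel n D U (i, k))) ∧
    (InitialSeg (n + 1) σ (Bel n D U (i, j)) → InitialSeg (n + 1) σ (Bel n D U (i, k)) →
      InitialSeg (n + 1) σ (Bel n D U (j, k))) ∧
    (InitialSeg (n + 1) σ (Bel n D U (j, k)) → InitialSeg (n + 1) σ (Bel n D U (i, k)) →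
      InitialSeg (n + 1) σ (Bel n D U (i, j))) := by
  have hjI := ht.mem_Icc
  have hjI' := Finset.mem_Icc.1 hjI
  rcases h.mem_or (v := j) (by omega) (by omega) with hj | hj
  · obtain ⟨hW, hd, n1, n2⟩ := ht.Bel_eq h hj
    have hv := (xcoord_eq_down h hT ht hj _).1 hx
    rw [hW]
    refine ⟨fun hX hY => hX.insert_union hinj (Bel_subset _) (Bel_subset _) hjI hd n1 n2 hv hY,
      fun _ hW' => hW'.of_insert_union hinj hσ hjI hd n1 n2 hv, fun _ hW' => ?_⟩
    rw [Finset.union_comm] at hW'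
    exact hW'.of_insert_union hinj hσ hjI hd.symm n2 n1 (hv.trans (mul_comm _ _))
  · obtain ⟨hW, hd, n1, n2⟩ := ht.Abo_eq h hj
    have hv := (xcoord_eq_up h hT ht hj (Finset.mem_Icc.1 (hσ j hjI)).2).1 hx
    have hσ' := reverse_maps hσ
    have hinj' := reverse_injOn hσ hinj
    simp only [← initialSeg_compl_iff hσ (Bel_subset _)]
    simp only [← Abo.eq_def]
    rw [hW]
    refine ⟨fun hX hY => hX.insert_union hinj' (Abo_subset _) (Abo_subset _) hjI hd n1 n2 hv hY,
      fun _ hW' => hW'.of_insert_union hinj' hσ' hjI hd n1 n2 hv, fun _ hW' => ?_⟩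
    rw [Finset.union_comm] at hW'
    exact hW'.of_insert_union hinj' hσ' hjI hd.symm n2 n1 (hv.trans (mul_comm _ _))

lemma allInitial_of_xcoord (h : LabelSplit n D U) (hT : IsTriangulation n D U T)
    (hσ : ∀ j ∈ Finset.Icc 1 (n + 1), σ j ∈ Finset.Icc 1 (n + 1))
    (hinj : Set.InjOn σ (Finset.Icc 1 (n + 1)))
    (hx : ∀ j ∈ Finset.Icc 1 (n + 1), xcoord n D U T j = (σ j : ℝ)) :
    AllInitial n D U T σ := by
  suffices H : ∀ r a b, relpos n D U a b = r → Joined n D U T a b →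
      (a < b → InitialSeg (n + 1) σ (Bel n D U (a, b))) ∧
      (b < a → InitialSeg (n + 1) σ (Bel n D U (b, a))) from
    fun a b hab he => (H _ a b rfl he).1 hab
  have sides {i j k : ℕ} (hij : i < j) (hjk : j < k) (e1 : Joined n D U T i j)
      (e2 : Joined n D U T j k) (e3 : Joined n D U T i k) :=
    have ht : IsTriangleOf n D U T i j k :=
      ⟨hij, hjk, e2.bounds.2.1, e1.edgeOf hij, e2.edgeOf hjk, e3.edgeOf (hij.trans hjk)⟩
    ht.initialSeg_sides h hT hσ hinj (hx j ht.mem_Icc)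
  intro r
  induction r using Nat.strong_induction_on with
  | _ r ih =>
    intro a b hr he
    obtain ⟨ha, hb, hne⟩ := he.bounds
    by_cases h1 : relpos n D U a b = 1
    · have hbd : ∀ δ, Bel n D U δ = ∅ ∨ Bel n D U δ = Finset.Icc 1 (n + 1) →
          InitialSeg (n + 1) σ (Bel n D U δ) := by
        rintro δ (hδ | hδ) <;> rw [hδ]
        · exact initialSeg_empty hσ
        · exact initialSeg_univ hσ
      exact ⟨fun hlt => hbd _ (h.Bel_boundary ⟨⟨hlt, hb⟩, Or.inl h1⟩),
        fun hlt => hbd _ (h.Bel_boundary ⟨⟨hlt, ha⟩, Or.inr h1⟩)⟩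
    · obtain ⟨c, hcyc, hac, hcb⟩ := he.exists_triangle h hT h1
      obtain ⟨-, hc, hane⟩ := hac.bounds
      have hbne := hcb.bounds.2.2
      have p1 := h.pos_lt ha
      have p2 := h.pos_lt hb
      have p3 := h.pos_lt hc
      have r1 := h.relpos_eq ha hb
      have r2 := h.relpos_eq ha hc
      have r3 := h.relpos_eq hc hb
      have l1 : relpos n D U a c < r := by simp only [Cyc] at hcyc; omega
      have l2 : relpos n D U c b < r := by simp only [Cyc] at hcyc; omega
      have i1 := ih _ l1 a c rfl hac
      have i2 := ih _ l2 c b rfl hcb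
      constructor
      · intro hlt
        rcases Nat.lt_or_gt_of_ne hane with g1 | g1
        · rcases Nat.lt_or_gt_of_ne hbne with g2 | g2
          · exact (sides g1 g2 hac hcb he).1 (i1.1 g1) (i2.1 g2)
          · exact (sides hlt g2 he hcb.symm hac).2.2 (i2.2 g2) (i1.1 g1)
        · exact (sides g1 hlt hac.symm he hcb).2.1 (i1.2 g1) (i2.1 (g1.trans hlt))
      · intro hlt
        rcases Nat.lt_or_gt_of_ne hane with g1 | g1
        · exact (sides hlt g1 he.symm hac hcb.symm).2.2 (i1.1 g1) (i2.2 (hlt.trans g1))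
        · rcases Nat.lt_or_gt_of_ne hbne with g2 | g2
          · exact (sides g2 hlt hcb he.symm hac.symm).2.1 (i2.1 g2) (i1.2 g1)
          · exact (sides g2 g1 hcb.symm hac.symm he.symm).1 (i2.2 g2) (i1.2 g1)

lemma AllInitial.value_down (h : LabelSplit n D U) (hI : AllInitial n D U T σ) {i j k : ℕ}
    (ht : IsTriangleOf n D U T i j k) (hj : j ∈ D) :
    (bel n D U (i, j) = 0 ∨ bel n D U (j, k) = 0) ∧
    σ j = bel n D U (i, j) + bel n D U (j, k) + 1 ∧ σ j = bel n D U (i, k) := by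
  obtain ⟨e1, e2, e3⟩ := ht.joined
  obtain ⟨hW, hd, n1, n2⟩ := ht.Bel_eq h hj
  have hc := card_insert_union hd n1 n2
  rw [← hW] at hc
  have hW' := hI i k (ht.1.trans ht.2.1) e3
  rw [hW] at hW'
  have := InitialSeg.value (Bel_subset _) (Bel_subset _) ht.mem_Icc hd n1 n2
    (hI i j ht.1 e1) (hI j k ht.2.1 e2) hW'
  exact ⟨this.1, this.2, this.2.trans hc.symm⟩

lemma AllInitial.value_up (h : LabelSplit n D U) (hI : AllInitial n D U T σ)
    (hσ : ∀ j ∈ Finset.Icc 1 (n + 1), σ j ∈ Finset.Icc 1 (n + 1)) {i j k : ℕ}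
    (ht : IsTriangleOf n D U T i j k) (hj : j ∈ U) :
    ((Abo n D U (i, j)).card = 0 ∨ (Abo n D U (j, k)).card = 0) ∧
    n + 1 + 1 - σ j = (Abo n D U (i, j)).card + (Abo n D U (j, k)).card + 1 ∧
    n + 1 + 1 - σ j = (Abo n D U (i, k)).card := by
  obtain ⟨e1, e2, e3⟩ := ht.joined
  obtain ⟨hW, hd, n1, n2⟩ := ht.Abo_eq h hj
  have hc := card_insert_union hd n1 n2
  rw [← hW] at hc
  have hA : ∀ a b, a < b → Joined n D U T a b →
      InitialSeg (n + 1) (fun x => n + 1 + 1 - σ x) (Abo n D U (a, b)) :=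
    fun a b hab he => (initialSeg_compl_iff hσ (Bel_subset _)).2 (hI a b hab he)
  have hW' := hA i k (ht.1.trans ht.2.1) e3
  rw [hW] at hW'
  have := InitialSeg.value (Abo_subset _) (Abo_subset _) ht.mem_Icc hd n1 n2
    (hA i j ht.1 e1) (hA j k ht.2.1 e2) hW'
  exact ⟨this.1, this.2, this.2.trans hc.symm⟩

lemma AllInitial.xcoord_eq (h : LabelSplit n D U) (hT : IsTriangulation n D U T)
    (hI : AllInitial n D U T σ) (hσ : ∀ j ∈ Finset.Icc 1 (n + 1), σ j ∈ Finset.Icc 1 (n + 1))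
    {j : ℕ} (hj : j ∈ Finset.Icc 1 (n + 1)) : xcoord n D U T j = (σ j : ℝ) := by
  have hj' := Finset.mem_Icc.1 hj
  obtain ⟨i, k, ht⟩ := exists_isTriangleOf h hT (j := j) (by omega) (by omega)
  rcases h.mem_or (v := j) (by omega) (by omega) with hjD | hjU
  · rw [xcoord_eq_down h hT ht hjD]
    obtain ⟨h0 | h0, h1, -⟩ := hI.value_down h ht hjD <;> rw [h1, h0] <;> ring
  · rw [xcoord_eq_up h hT ht hjU (Finset.mem_Icc.1 (hσ j hj)).2]
    obtain ⟨h0 | h0, h1, -⟩ := hI.value_up h hσ ht hjU <;> rw [h1, h0] <;> ring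

/-- If all edges have initial segments below them, then every diagonal of the triangulation
yields an arc between two labels with consecutive values of `σ`. -/
lemma AllInitial.spine_values (h : LabelSplit n D U) (hT : IsTriangulation n D U T)
    (hI : AllInitial n D U T σ) (hσ : ∀ j ∈ Finset.Icc 1 (n + 1), σ j ∈ Finset.Icc 1 (n + 1))
    {δ : ℕ × ℕ} (hδ : δ ∈ T) :
    σ (spineSrc n D U T δ) = bel n D U δ ∧ σ (spineTgt n D U T δ) = bel n D U δ + 1 ∧
      0 < bel n D U δ ∧ bel n D U δ < n + 1 := by
  obtain ⟨i, j, k, hj, ht, hs⟩ := spineSrc_spec h hT hδ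
  obtain ⟨i', j', k', hj', ht', hs'⟩ := spineTgt_spec h hT hδ
  rw [hj, hj']
  have hpos : 0 < bel n D U δ := Finset.card_pos.2 ⟨j, hs.mem_Bel h ht⟩
  have hpos' : 0 < (Abo n D U δ).card :=
    Finset.card_pos.2 ⟨j', Finset.mem_sdiff.2 ⟨ht'.mem_Icc, hs'.notMem_Bel h ht'⟩⟩
  have hcard := card_Abo (n := n) (D := D) (U := U) δ
  have hb := Finset.mem_Icc.1 (hσ j ht.mem_Icc)
  have hb' := Finset.mem_Icc.1 (hσ j' ht'.mem_Icc)
  refine ⟨?_, ?_, hpos, by omega⟩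
  · rcases hs with ⟨hjD, rfl⟩ | ⟨hjU, rfl | rfl⟩
    · exact (hI.value_down h ht hjD).2.2
    · have := hI.value_up h hσ ht hjU; omega
    · have := hI.value_up h hσ ht hjU; omega
  · rcases hs' with ⟨hjU, rfl⟩ | ⟨hjD, rfl | rfl⟩
    · have := hI.value_up h hσ ht' hjU; omega
    · have := hI.value_down h ht' hjD; omega
    · have := hI.value_down h ht' hjD; omega

/-- If all edges have initial segments below them, then every label of value at least `2` is the
target of an arc of the spine. -/
lemma AllInitial.exists_spineTgt_eq (h : LabelSplit n D U) (hT : IsTriangulation n D U T)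
    (hI : AllInitial n D U T σ) (hσ : ∀ j ∈ Finset.Icc 1 (n + 1), σ j ∈ Finset.Icc 1 (n + 1))
    {j : ℕ} (hj : j ∈ Finset.Icc 1 (n + 1)) (h2 : 2 ≤ σ j) :
    ∃ δ ∈ T, spineTgt n D U T δ = j := by
  have hj' := Finset.mem_Icc.1 hj
  have hσj := Finset.mem_Icc.1 (hσ j hj)
  obtain ⟨i, k, ht⟩ := exists_isTriangleOf h hT (j := j) (by omega) (by omega)
  have key : ∀ a b, EdgeOf n D U T a b → IsLowerSide D U i j k (a, b) →
      bel n D U (a, b) ≠ 0 → ∃ δ ∈ T, spineTgt n D U T δ = j := by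
    rintro a b (he | he) hl h0
    · exact ⟨_, he, spineTgt_eq h hT he ht hl⟩
    · have hn := hl.notMem_Bel h ht
      rcases h.Bel_boundary he with hB | hB
      · exact absurd (by rw [bel, hB]; rfl) h0
      · rw [hB] at hn; exact absurd hj hn
  obtain ⟨-, -, -, e1, e2, e3⟩ := id ht
  rcases h.mem_or (v := j) (by omega) (by omega) with hjD | hjU
  · have hv := hI.value_down h ht hjD
    by_cases h0 : bel n D U (i, j) = 0
    · exact key j k e2 (Or.inr ⟨hjD, Or.inr rfl⟩) (by omega)
    · exact key i j e1 (Or.inr ⟨hjD, Or.inl rfl⟩) h0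
  · have hv := hI.value_up h hσ ht hjU
    have hc := card_Abo (n := n) (D := D) (U := U) (i, k)
    exact key i k e3 (Or.inl ⟨hjU, rfl⟩) (by omega)

lemma allInitial_of_reachable (h : LabelSplit n D U) (hT : IsTriangulation n D U T)
    (hσ : ∀ j ∈ Finset.Icc 1 (n + 1), σ j ∈ Finset.Icc 1 (n + 1))
    (hinj : Set.InjOn σ (Finset.Icc 1 (n + 1)))
    (hr : ∀ i ∈ Finset.Icc 1 (n + 1), ∀ j ∈ Finset.Icc 1 (n + 1), σ i < σ j →
      Relation.ReflTransGen (SpineArc n D U T) i j) : AllInitial n D U T σ := by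
  intro a b hab he
  refine initialSeg_of_downClosed hinj hσ (Bel_subset _) fun x hx y hy hlt => ?_
  refine (hr y hy x (Bel_subset _ hx) hlt).head_induction_on hx ?_
  exact fun harc _ hmem => harc.mem_Bel h hT hab he hmem

end Equivalences

/-- For a triangulation `T` and a permutation `σ` of `[n+1]`, the
following are equivalent: (a) the spine of `T` is the directed Hamiltonian path
`σ⁻¹(1) → σ⁻¹(2) → … → σ⁻¹(n+1)`; (b) whenever `σ i < σ j` there is a directed path
from `i` to `j` in the spine; (c) `x_j(T) = σ(j)` for all `j ∈ [n+1]`. -/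
theorem spine_path_tfae (n : ℕ) (hn : 1 ≤ n) (D U : Finset ℕ)
    (hUD : D ∪ U = Finset.Icc 1 (n + 1)) (hdisj : Disjoint D U)
    (T : Finset (ℕ × ℕ)) (hT : IsTriangulation n D U T)
    (σ : Equiv.Perm ℕ) (hσ : ∀ j ∈ Finset.Icc 1 (n + 1), σ j ∈ Finset.Icc 1 (n + 1)) :
    ((∀ p q : ℕ, SpineArc n D U T p q ↔
        ∃ k ∈ Finset.Icc 1 n, p = σ.symm k ∧ q = σ.symm (k + 1)) ↔
      (∀ i ∈ Finset.Icc 1 (n + 1), ∀ j ∈ Finset.Icc 1 (n + 1), σ i < σ j →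
        Relation.ReflTransGen (SpineArc n D U T) i j)) ∧
    ((∀ i ∈ Finset.Icc 1 (n + 1), ∀ j ∈ Finset.Icc 1 (n + 1), σ i < σ j →
        Relation.ReflTransGen (SpineArc n D U T) i j) ↔
      (∀ j ∈ Finset.Icc 1 (n + 1), xcoord n D U T j = (σ j : ℝ))) := by
  have h : LabelSplit n D U := ⟨hUD, hdisj⟩
  have hinj : Set.InjOn σ (Finset.Icc 1 (n + 1)) := σ.injective.injOn
  have hsymm : ∀ k ∈ Finset.Icc 1 (n + 1), σ.symm k ∈ Finset.Icc 1 (n + 1) := fun k hk => by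
    obtain ⟨j, hj, rfl⟩ := Finset.surj_on_of_inj_on_of_card_le (fun v _ => σ v) hσ
      (fun a b ha hb hab => hinj ha hb hab) le_rfl k hk
    simpa using hj
  have path_reach (ha : ∀ p q : ℕ, SpineArc n D U T p q ↔
      ∃ k ∈ Finset.Icc 1 n, p = σ.symm k ∧ q = σ.symm (k + 1)) :
      ∀ i ∈ Finset.Icc 1 (n + 1), ∀ j ∈ Finset.Icc 1 (n + 1), σ i < σ j →
        Relation.ReflTransGen (SpineArc n D U T) i j := by
    intro i hi j hj hlt
    have hi' := Finset.mem_Icc.1 (hσ i hi)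
    have hj' := Finset.mem_Icc.1 (hσ j hj)
    have key : ∀ l, σ i ≤ l → l ≤ n + 1 →
        Relation.ReflTransGen (SpineArc n D U T) i (σ.symm l) := by
      intro l hl
      induction l, hl using Nat.le_induction with
      | base => intro _; rw [σ.symm_apply_apply]
      | succ l hl ih =>
        intro hl'
        exact (ih (by omega)).tail
          ((ha _ _).2 ⟨l, Finset.mem_Icc.2 ⟨by omega, by omega⟩, rfl, rfl⟩)
    simpa using key (σ j) hlt.le hj'.2
  have initial_path (hI : AllInitial n D U T σ) (p q : ℕ) : SpineArc n D U T p q ↔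
      ∃ k ∈ Finset.Icc 1 n, p = σ.symm k ∧ q = σ.symm (k + 1) := by
    constructor
    · rintro ⟨δ, hδ, rfl, rfl⟩
      obtain ⟨h1, h2, h3, h4⟩ := hI.spine_values h hT hσ hδ
      exact ⟨bel n D U δ, Finset.mem_Icc.2 ⟨h3, by omega⟩, σ.eq_symm_apply.2 h1,
        σ.eq_symm_apply.2 h2⟩
    · rintro ⟨k, hk, rfl, rfl⟩
      rw [Finset.mem_Icc] at hk
      obtain ⟨δ, hδ, hδ'⟩ := hI.exists_spineTgt_eq h hT hσ
        (hsymm (k + 1) (Finset.mem_Icc.2 ⟨by omega, by omega⟩)) (by simp; omega)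
      obtain ⟨h1, h2, -⟩ := hI.spine_values h hT hσ hδ
      refine ⟨δ, hδ, σ.eq_symm_apply.2 ?_, hδ'⟩
      rw [hδ', σ.apply_symm_apply] at h2
      omega
  exact ⟨⟨path_reach, fun hb => initial_path (allInitial_of_reachable h hT hσ hinj hb)⟩,
    fun hb j hj => (allInitial_of_reachable h hT hσ hinj hb).xcoord_eq h hT hσ hj,
    fun hc => path_reach (initial_path (allInitial_of_xcoord h hT hσ hinj hc))⟩

end Spines
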